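/- arXiv:1909.03959 — 4 statements merged into one kernel-verified Lean document; each statement's English description precedes it below -/
import Mathlib

section
/- Let c be a squarefree positive integer, let c' be a positive divisor of c, and let ψ be a Dirichlet character modulo c' with values in ℂ. For any positive multiple d of c' define the Gauss sum τ_d(ψ) := ∑_{a ∈ (ℤ/dℤ)^×} ψ(a mod c')·exp(2πi·a/d), where ψ(a mod c') is the value of ψ at the image of a under the reduction map (ℤ/dℤ)^× → (ℤ/c'ℤ)^×. Then τ_c(ψ) = (∏_{ℓ} (−ψ(ℓ)))·τ_{c'}(ψ), where ℓ runs over the prime divisors of c/c' and ψ(ℓ) denotes the value of ψ at the class of ℓ in (ℤ/c'ℤ)^×. -/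
/-- The (generally imprimitive) Gauss sum `τ_d(ψ)` at level `d` of a Dirichlet character `ψ`
modulo `c'`, for a positive multiple `d` of `c'`:
`τ_d(ψ) = ∑_{a ∈ (ℤ/dℤ)ˣ} ψ(a mod c') · exp(2πi·a/d)`,
where `ψ(a mod c')` is the value of `ψ` at the image of `a` under the reduction map
`(ℤ/dℤ)ˣ → (ℤ/c'ℤ)ˣ` and the exponential is evaluated at the canonical representative of `a`. -/
noncomputable def gaussTau (c' : ℕ) (ψ : DirichletCharacter ℂ c') (d : ℕ) (hd : 0 < d)
    (h : c' ∣ d) : ℂ :=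
  letI : NeZero d := ⟨hd.ne'⟩
  ∑ a : (ZMod d)ˣ,
    ψ (ZMod.castHom h (ZMod c') (a : ZMod d)) *
      Complex.exp (2 * Real.pi * Complex.I * ((a : ZMod d).val : ℂ) / (d : ℂ))

open DirichletCharacter in
/-- The level `d` Gauss sum of `ψ` is the Gauss sum of the character induced by `ψ` modulo `d`. -/
lemma gaussTau_eq_gaussSum_changeLevel {c' d : ℕ} [NeZero d] (ψ : DirichletCharacter ℂ c')
    (hd : 0 < d) (h : c' ∣ d) :
    gaussTau c' ψ d hd h = gaussSum (changeLevel h ψ) ZMod.stdAddChar := by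
  have key (a : (ZMod d)ˣ) : ψ (ZMod.castHom h (ZMod c') (a : ZMod d)) *
      Complex.exp (2 * Real.pi * Complex.I * ((a : ZMod d).val : ℂ) / (d : ℂ)) =
      changeLevel h ψ a * ZMod.stdAddChar (a : ZMod d) := by
    rw [changeLevel_eq_cast_of_dvd, ZMod.stdAddChar_apply, ZMod.toCircle_apply, ZMod.castHom_apply]
  unfold gaussTau gaussSum
  rw [Finset.sum_congr rfl fun a _ ↦ key a]
  refine Finset.sum_of_injOn (fun a : (ZMod d)ˣ ↦ (a : ZMod d)) (Units.val_injective.injOn)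
    (by simp) (fun a _ ha ↦ ?_) (fun _ _ ↦ rfl)
  rw [MulChar.map_nonunit, zero_mul]
  rintro ⟨u, rfl⟩
  exact ha ⟨u, by simp, rfl⟩

/-- Restricting the standard additive character modulo `n = d * p` to multiples of `p` gives the
standard additive character modulo `d`. -/
lemma ZMod.stdAddChar_natCast_mul {n d p : ℕ} [NeZero n] [NeZero d] [NeZero p]
    (hn : n = d * p) (x : ℤ) :
    stdAddChar ((p * x : ℤ) : ZMod n) = stdAddChar (x : ZMod d) := by
  have hd : (d : ℂ) ≠ 0 := NeZero.ne _
  have hp : (p : ℂ) ≠ 0 := NeZero.ne _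
  rw [stdAddChar_coe, stdAddChar_coe, hn]
  congr 1
  push_cast
  field_simp

/-- Decomposition of the standard additive character along a Bézout relation. -/
lemma ZMod.stdAddChar_eq_mul_of_bezout {d p : ℕ} [NeZero d] [NeZero p] {u v : ℤ}
    (huv : p * u + d * v = 1) (a : ZMod (d * p)) :
    stdAddChar a = stdAddChar ((u : ZMod d) * castHom (dvd_mul_right d p) (ZMod d) a) *
      stdAddChar ((v : ZMod p) * castHom (dvd_mul_left p d) (ZMod p) a) := by
  obtain ⟨x, rfl⟩ := intCast_surjective a
  have hdec : ((x : ℤ) : ZMod (d * p)) = ((p * (u * x) : ℤ) : ZMod (d * p)) +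
      ((d * (v * x) : ℤ) : ZMod (d * p)) := by
    rw [← Int.cast_add]
    congr 1
    linear_combination (-x) * huv
  simp only [map_intCast, ← Int.cast_mul]
  rw [hdec, AddChar.map_add_eq_mul, stdAddChar_natCast_mul rfl,
    stdAddChar_natCast_mul (mul_comm d p)]

/-- Passing to level `d * p` multiplies a character by the trivial character modulo `p`. -/
lemma DirichletCharacter.changeLevel_mul_apply {R : Type*} [CommMonoidWithZero R] {c' d p : ℕ}
    (hdp : d.Coprime p) (h : c' ∣ d) (ψ : DirichletCharacter R c') (a : ZMod (d * p)) :
    changeLevel (h.mul_right p) ψ a =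
      changeLevel h ψ (ZMod.chineseRemainder hdp a).1 *
        (1 : MulChar (ZMod p) R) (ZMod.chineseRemainder hdp a).2 := by
  by_cases ha : IsUnit a
  · have ha' := Prod.isUnit_iff.mp (ha.map (ZMod.chineseRemainder hdp))
    obtain ⟨u, hu⟩ := ha'.1
    obtain ⟨w, rfl⟩ := ha
    rw [MulChar.one_apply ha'.2, mul_one, ← hu, changeLevel_eq_cast_of_dvd,
      changeLevel_eq_cast_of_dvd, hu]
    congr 1
    exact (RingHom.congr_fun (Subsingleton.elim (ZMod.castHom (h.mul_right p) (ZMod c'))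
      ((ZMod.castHom h (ZMod c')).comp ((RingHom.fst _ _).comp
        (ZMod.chineseRemainder hdp).toRingHom))) w :)
  · rw [MulChar.map_nonunit _ ha]
    have ha' : ¬ IsUnit (ZMod.chineseRemainder hdp a) := by
      rwa [MulEquiv.isUnit_map]
    rw [Prod.isUnit_iff, not_and_or] at ha'
    rcases ha' with h1 | h2
    · rw [MulChar.map_nonunit _ h1, zero_mul]
    · rw [MulChar.map_nonunit _ h2, mul_zero]

open DirichletCharacter in
/-- Adding a prime `p` to the level multiplies the Gauss sum by `-ψ(p)`. -/
lemma gaussSum_changeLevel_mul_prime {c' d p : ℕ} [NeZero d] [NeZero p] (hp : p.Prime)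
    (hdp : d.Coprime p) (h : c' ∣ d) (ψ : DirichletCharacter ℂ c') :
    gaussSum (changeLevel (h.mul_right p) ψ) ZMod.stdAddChar =
      -ψ (p : ZMod c') * gaussSum (changeLevel h ψ) ZMod.stdAddChar := by
  have : Fact p.Prime := ⟨hp⟩
  obtain ⟨u, v, huv⟩ : ∃ u v : ℤ, p * u + d * v = 1 := by
    obtain ⟨u, v, huv⟩ := hdp.symm.isCoprime
    exact ⟨u, v, by linear_combination huv⟩
  have hu : (p : ZMod d) * (u : ZMod d) = 1 := by
    simpa using congrArg (Int.cast : ℤ → ZMod d) huv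
  have hv : (d : ZMod p) * (v : ZMod p) = 1 := by
    simpa using congrArg (Int.cast : ℤ → ZMod p) huv
  let U : (ZMod d)ˣ := ⟨u, p, by rw [mul_comm, hu], hu⟩
  let V : (ZMod p)ˣ := ⟨v, d, by rw [mul_comm, hv], hv⟩
  have hsplit : gaussSum (changeLevel (h.mul_right p) ψ) ZMod.stdAddChar =
      gaussSum (changeLevel h ψ) (ZMod.stdAddChar.mulShift (U : ZMod d)) *
        gaussSum (1 : MulChar (ZMod p) ℂ) (ZMod.stdAddChar.mulShift (V : ZMod p)) := by
    unfold gaussSum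
    rw [Fintype.sum_mul_sum, ← Fintype.sum_prod_type']
    refine Fintype.sum_equiv (ZMod.chineseRemainder hdp).toEquiv _ _ fun a ↦ ?_
    have h1 : ZMod.castHom (dvd_mul_right d p) (ZMod d) a = (ZMod.chineseRemainder hdp a).1 :=
      (RingHom.congr_fun (Subsingleton.elim _ ((RingHom.fst _ _).comp
        (ZMod.chineseRemainder hdp).toRingHom)) a :)
    have h2 : ZMod.castHom (dvd_mul_left p d) (ZMod p) a = (ZMod.chineseRemainder hdp a).2 :=
      (RingHom.congr_fun (Subsingleton.elim _ ((RingHom.snd _ _).comp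
        (ZMod.chineseRemainder hdp).toRingHom)) a :)
    rw [changeLevel_mul_apply hdp h, ZMod.stdAddChar_eq_mul_of_bezout huv, h1, h2]
    exact mul_mul_mul_comm _ _ _ _
  have hψ : changeLevel h ψ ((U⁻¹ : (ZMod d)ˣ) : ZMod d) = ψ (p : ZMod c') := by
    rw [changeLevel_eq_cast_of_dvd]
    congr 1
    exact ZMod.cast_natCast h p
  have htriv : gaussSum (1 : MulChar (ZMod p) ℂ) ZMod.stdAddChar = -1 := by
    refine gaussSum_one_left fun h1 ↦ one_ne_zero (α := ZMod p) (ZMod.injective_stdAddChar ?_)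
    simp [h1]
  rw [hsplit, gaussSum_mulShift_eq, gaussSum_mulShift_eq, htriv, MulChar.inv_apply,
    Ring.inverse_unit, hψ, inv_one, MulChar.one_apply_coe]
  ring

/-- Let `c` be a squarefree positive integer, `c'` a positive divisor of `c` and `ψ` a
Dirichlet character modulo `c'`.  Then `τ_c(ψ) = (∏_{ℓ ∣ c/c' prime} (−ψ(ℓ)))·τ_{c'}(ψ)`. -/
theorem statement1 (c : ℕ) (hc : 0 < c) (hsq : Squarefree c)
    (c' : ℕ) (hc' : 0 < c') (hdvd : c' ∣ c) (ψ : DirichletCharacter ℂ c') :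
    gaussTau c' ψ c hc hdvd =
      (∏ ℓ ∈ (c / c').primeFactors, -ψ (ℓ : ZMod c')) * gaussTau c' ψ c' hc' dvd_rfl := by
  have hm : c = c' * (c / c') := (Nat.mul_div_cancel' hdvd).symm
  generalize c / c' = m at hm ⊢
  induction m using induction_on_primes generalizing c with
  | zero => omega
  | one =>
    obtain rfl : c = c' := by simpa using hm
    simp
  | prime_mul p a hp ih =>
    obtain rfl : c = c' * a * p := by rw [hm]; ring
    have hd : 0 < c' * a := Nat.pos_of_mul_pos_right hc
    have : NeZero (c' * a) := ⟨hd.ne'⟩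
    have : NeZero p := ⟨hp.ne_zero⟩
    have hcop : (c' * a).Coprime p := Nat.coprime_of_squarefree_mul hsq
    have hpa : p ∉ a.primeFactors := fun hmem ↦ hp.one_lt.ne'
      (Nat.eq_one_of_dvd_coprimes hcop
        ((Nat.dvd_of_mem_primeFactors hmem).mul_left c') dvd_rfl)
    have ha : a ≠ 0 := by rintro rfl; simp at hd
    rw [gaussTau_eq_gaussSum_changeLevel,
      gaussSum_changeLevel_mul_prime hp hcop (dvd_mul_right c' a),
      ← gaussTau_eq_gaussSum_changeLevel ψ hd,
      ih (c' * a) hd hsq.of_mul_left (dvd_mul_right c' a) rfl,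
      Nat.primeFactors_mul hp.ne_zero ha, hp.primeFactors, ← Finset.insert_eq,
      Finset.prod_insert hpa, mul_assoc]
end

section
/- Let p be an odd prime number, A a finite abelian group, c a squarefree positive integer, and K an algebraic closure of the field ℚ_p of p-adic numbers. Suppose given, for each character ψ : A → K^× of A, a positive divisor c_ψ of c. For each ψ set n_ψ := p if p divides c but p does not divide c_ψ, and n_ψ := 1 otherwise, and let e_ψ := |A|^{-1}·∑_{g ∈ A} ψ(g)^{-1}·g, an element of the group algebra K[A]. Fix i ∈ {1,2} and assume that for each positive divisor d of c there exists a subgroup H_d of A satisfying both: (i) for every character ψ of A, c_ψ divides d if and only if H_d is contained in the kernel of ψ; and (ii) the order |H_d| divides ∏_{ℓ} (ℓ + (−1)^i), the product running over the prime divisors ℓ of c/d. Then the element ∑_{ψ} ((c_ψ/c)·n_ψ)^i·e_ψ of K[A], the sum running over all characters ψ of A and the rational numbers ((c_ψ/c)·n_ψ)^i being viewed in K, is the image of a unit of the group algebra ℤ_p[A] under the canonical ring homomorphism ℤ_p[A] → K[A] induced by ℤ_p → ℚ_p → K. -/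
/-- The canonical coefficient-change ring homomorphism `R[A] → S[A]` induced by a ring
homomorphism `f : R → S` (for `A` a commutative monoid), sending `∑ r_g·g` to `∑ f(r_g)·g`. -/
noncomputable def coeffRingHom {R S : Type*} [CommRing R] [CommRing S] (f : R →+* S)
    (A : Type*) [CommMonoid A] : MonoidAlgebra R A →+* MonoidAlgebra S A :=
  MonoidAlgebra.liftNCRingHom (MonoidAlgebra.singleOneRingHom.comp f)
    (MonoidAlgebra.of S A) (fun _ _ => Commute.all _ _)

open Finset

section Fourier

variable {A K : Type*} [CommGroup A] [Field K]

/-- Evaluation of elements of the group algebra at a character. -/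
noncomputable def charEval (ψ : A →* Kˣ) : MonoidAlgebra K A →ₐ[K] K :=
  MonoidAlgebra.lift K K A ((Units.coeHom K).comp ψ)

lemma charEval_single (ψ : A →* Kˣ) (g : A) (r : K) :
    charEval ψ (MonoidAlgebra.single g r) = r * (ψ g : K) := by
  simp [charEval, MonoidAlgebra.lift_single]

/-- Orthogonality: the sum of the values of a character over a subgroup. -/
lemma sum_subgroup_char (ψ : A →* Kˣ) (H : Subgroup A) [Fintype H] [Decidable (H ≤ ψ.ker)] :
    ∑ h : H, (ψ (h : A) : K) = if H ≤ ψ.ker then (Nat.card H : K) else 0 := by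
  classical
  have key := sum_hom_units (((Units.coeHom K).comp ψ).comp H.subtype)
  have hiff : ((Units.coeHom K).comp ψ).comp H.subtype = 1 ↔ H ≤ ψ.ker := by
    simp [DFunLike.ext_iff, SetLike.le_def, MonoidHom.mem_ker]
  simp only [hiff] at key
  simpa [Nat.card_eq_fintype_card] using key

variable [Fintype A] [CharZero K] [IsAlgClosed K]

/-- Orthogonality: the sum of the values of all characters at a group element. -/
lemma sum_dual_apply [Fintype (A →* Kˣ)] [DecidableEq A] (g : A) :
    ∑ ψ : A →* Kˣ, (ψ g : K) = if g = 1 then (Fintype.card A : K) else 0 := by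
  classical
  have : NeZero (Monoid.exponent A : K) :=
    ⟨Nat.cast_ne_zero.mpr Monoid.exponent_ne_zero_of_finite⟩
  have key := sum_hom_units ((Units.coeHom K).comp (MonoidHom.eval (N := Kˣ) g))
  have hiff : (Units.coeHom K).comp (MonoidHom.eval (N := Kˣ) g) = 1 ↔ g = 1 := by
    rw [← CommGroup.forall_apply_eq_apply_iff A (M := K)]
    simp [DFunLike.ext_iff]
  have hcard := CommGroup.card_monoidHom_of_hasEnoughRootsOfUnity A K
  simp only [Nat.card_eq_fintype_card] at hcard
  simp only [hiff, hcard] at key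
  simpa using key

/-- Fourier inversion in the group algebra of a finite abelian group. -/
lemma sum_charEval_smul_idempotent [Fintype (A →* Kˣ)] (x : MonoidAlgebra K A) :
    ∑ ψ : A →* Kˣ, charEval ψ x • ((Fintype.card A : K)⁻¹ •
      ∑ g : A, (((ψ g)⁻¹ : Kˣ) : K) • MonoidAlgebra.of K A g) = x := by
  classical
  induction x using MonoidAlgebra.induction_linear with
  | zero => simp
  | add x y hx hy => simp only [map_add, add_smul, sum_add_distrib, hx, hy]
  | single a r =>
    have hA : (Fintype.card A : K) ≠ 0 := Nat.cast_ne_zero.mpr Fintype.card_ne_zero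
    simp only [charEval_single, smul_sum, smul_smul]
    rw [sum_comm]
    have hg (g : A) : ∑ ψ : A →* Kˣ, (r * (ψ a : K) * ((Fintype.card A : K)⁻¹ *
        (((ψ g)⁻¹ : Kˣ) : K))) • MonoidAlgebra.of K A g =
        if g = a then MonoidAlgebra.single a r else 0 := by
      rw [← sum_smul]
      have h1 (ψ : A →* Kˣ) : r * (ψ a : K) * ((Fintype.card A : K)⁻¹ * (((ψ g)⁻¹ : Kˣ) : K)) =
          r * (Fintype.card A : K)⁻¹ * (ψ (a * g⁻¹) : K) := by
        simp only [map_mul, map_inv, Units.val_mul]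
        ring
      simp only [h1, ← mul_sum, sum_dual_apply, mul_inv_eq_one]
      by_cases h : g = a
      · subst h
        simp [hA]
      · simp [h, Ne.symm h]
    rw [sum_congr rfl fun g _ => hg g, sum_ite_eq' univ a, if_pos (mem_univ a)]

/-- An element of the group algebra is determined by its values at all characters. -/
lemma charEval_ext {x y : MonoidAlgebra K A} (h : ∀ ψ : A →* Kˣ, charEval ψ x = charEval ψ y) :
    x = y := by
  have := Fintype.ofFinite (A →* Kˣ)
  rw [← sum_charEval_smul_idempotent x, ← sum_charEval_smul_idempotent y]
  simp only [h]

end Fourier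

lemma coeffRingHom_single {R S A : Type*} [CommRing R] [CommRing S] [CommMonoid A] (f : R →+* S)
    (g : A) (r : R) :
    coeffRingHom f A (MonoidAlgebra.single g r) = MonoidAlgebra.single g (f r) := by
  simp [coeffRingHom, MonoidAlgebra.liftNCRingHom, MonoidAlgebra.single_mul_single]

lemma coeffRingHom_injective {R S A : Type*} [CommRing R] [CommRing S] [CommMonoid A]
    {f : R →+* S} (hf : Function.Injective f) : Function.Injective (coeffRingHom f A) := by
  have h : coeffRingHom f A = MonoidAlgebra.mapRingHom A f := by
    ext <;> simp [coeffRingHom_single]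
  rw [h]
  exact MonoidAlgebra.map_injective (f : R →+ S) hf

/-- If the products of the `t ℓ` are divisible by the orders of suitable subgroups, then the
function `ψ ↦ ∏_{ℓ, P ψ ℓ} (1 + t ℓ)` on characters comes from an element of the group algebra
over the coefficient ring. -/
lemma exists_charEval_eq_prod {A K R ι : Type*} [CommGroup A] [Fintype A] [Field K] [CommRing R]
    (f : R →+* K) (S : Finset ι) (t : ι → R) (P : (A →* Kˣ) → ι → Prop)
    [∀ ψ, DecidablePred (P ψ)]
    (hH : ∀ T ⊆ S, ∃ H : Subgroup A, (∀ ψ : A →* Kˣ, H ≤ ψ.ker ↔ ∀ ℓ ∈ T, P ψ ℓ) ∧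
      (Nat.card H : R) ∣ ∏ ℓ ∈ T, t ℓ) :
    ∃ y : MonoidAlgebra R A, ∀ ψ : A →* Kˣ,
      charEval ψ (coeffRingHom f A y) = ∏ ℓ ∈ S, if P ψ ℓ then f (1 + t ℓ) else 1 := by
  classical
  have hy (T : Finset ι) (hT : T ⊆ S) : ∃ y : MonoidAlgebra R A, ∀ ψ : A →* Kˣ,
      charEval ψ (coeffRingHom f A y) = ∏ ℓ ∈ T, if P ψ ℓ then f (t ℓ) else 0 := by
    obtain ⟨H, hker, q, hq⟩ := hH T hT
    refine ⟨∑ h : H, MonoidAlgebra.single (h : A) q, fun ψ => ?_⟩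
    simp only [map_sum, coeffRingHom_single, charEval_single, ← mul_sum, sum_subgroup_char, hker]
    split_ifs with h
    · rw [prod_congr rfl fun ℓ hℓ => if_pos (h ℓ hℓ), ← map_prod, hq]
      simp [mul_comm]
    · push Not at h
      obtain ⟨ℓ, hℓ, hP⟩ := h
      rw [prod_eq_zero hℓ (if_neg hP), mul_zero]
  choose! y hy using hy
  refine ⟨∑ T ∈ S.powerset, y T, fun ψ => ?_⟩
  rw [map_sum, map_sum, sum_congr rfl fun T hT => hy T (mem_powerset.mp hT) ψ, ← prod_one_add]
  refine prod_congr rfl fun ℓ _ => ?_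
  split_ifs <;> simp

lemma Squarefree.dvd_div_prod_iff {c m : ℕ} (hsq : Squarefree c) (hm : m ∣ c) {T : Finset ℕ}
    (hT : T ⊆ c.primeFactors) : m ∣ c / ∏ ℓ ∈ T, ℓ ↔ ∀ ℓ ∈ T, ¬ ℓ ∣ m := by
  have hdvd : ∏ ℓ ∈ T, ℓ ∣ c :=
    (prod_dvd_prod_of_subset _ _ _ hT).trans (Nat.prod_primeFactors_dvd c)
  obtain ⟨d, rfl⟩ := hdvd
  have hpos : 0 < ∏ ℓ ∈ T, ℓ := Nat.pos_of_ne_zero fun h => hsq.ne_zero (by simp [h])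
  rw [Nat.mul_div_cancel_left _ hpos]
  constructor
  · intro h ℓ hℓ hℓm
    exact (Nat.prime_of_mem_primeFactors (hT hℓ)).not_isUnit
      (hsq ℓ (mul_dvd_mul (dvd_prod_of_mem _ hℓ) (hℓm.trans h)))
  · intro h
    refine Nat.Coprime.dvd_of_dvd_mul_left (Nat.Coprime.prod_right fun ℓ hℓ => ?_) hm
    exact ((Nat.prime_of_mem_primeFactors (hT hℓ)).coprime_iff_not_dvd.mpr (h ℓ hℓ)).symm

lemma Squarefree.eq_mul_prod_erase {c m p : ℕ} (hsq : Squarefree c) (hm : m ∣ c) (hp : p.Prime) :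
    c = m * (if p ∣ c ∧ ¬ p ∣ m then p else 1) *
      ∏ ℓ ∈ c.primeFactors.erase p, if ¬ ℓ ∣ m then ℓ else 1 := by
  have hc0 := hsq.ne_zero
  have hmf : m.primeFactors = c.primeFactors.filter (· ∣ m) := by
    ext ℓ
    simp only [Nat.mem_primeFactors, mem_filter]
    have := ne_zero_of_dvd_ne_zero hc0 hm
    exact ⟨fun h => ⟨⟨h.1, h.2.1.trans hm, hc0⟩, h.2.1⟩, fun h => ⟨h.1.1, h.2, this⟩⟩
  have hsplit : m * ∏ ℓ ∈ c.primeFactors, (if ¬ ℓ ∣ m then ℓ else 1) = c := by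
    conv_rhs => rw [← Nat.prod_primeFactors_of_squarefree hsq]
    rw [← prod_filter,
      ← prod_filter_mul_prod_filter_not c.primeFactors (· ∣ m), ← hmf,
      Nat.prod_primeFactors_of_squarefree (hsq.squarefree_of_dvd hm)]
  by_cases hpc : p ∣ c
  · have hmem : p ∈ c.primeFactors := Nat.mem_primeFactors.mpr ⟨hp, hpc, hc0⟩
    rw [← mul_prod_erase _ _ hmem, ← mul_assoc] at hsplit
    simpa [hpc] using hsplit.symm
  · have hmem : p ∉ c.primeFactors := fun h => hpc (Nat.dvd_of_mem_primeFactors h)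
    simpa [hpc, erase_eq_of_notMem hmem] using hsplit.symm

lemma add_neg_one_pow_dvd_pow_sub_one {R : Type*} [CommRing R] (x : R) {i : ℕ}
    (hi : i = 1 ∨ i = 2) : x + (-1) ^ i ∣ x ^ i - 1 := by
  rcases hi with rfl | rfl
  · exact ⟨1, by ring⟩
  · exact ⟨x - 1, by ring⟩

lemma PadicInt.isUnit_natCast_of_prime {p ℓ : ℕ} [hp : Fact p.Prime] (hℓ : ℓ.Prime)
    (hne : ℓ ≠ p) : IsUnit (ℓ : ℤ_[p]) := by
  rw [PadicInt.isUnit_iff, PadicInt.norm_natCast_eq_one_iff]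
  exact (Nat.coprime_primes hp.out hℓ).mpr hne.symm

/-- Let `p` be an odd prime, `A` a finite abelian group, `c` a squarefree positive integer and
`K` an algebraic closure of `ℚ_p`.  Suppose given, for each character `ψ : A → Kˣ`, a positive
divisor `c_ψ` of `c`; set `n_ψ := p` if `p ∣ c` and `p ∤ c_ψ`, and `n_ψ := 1` otherwise, and let
`e_ψ := |A|⁻¹·∑_{g ∈ A} ψ(g)⁻¹·g ∈ K[A]`.  Fix `i ∈ {1,2}` and assume that for each positive
divisor `d` of `c` there is a subgroup `H_d` of `A` such that (i) `c_ψ ∣ d ↔ H_d ≤ ker ψ` for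
all `ψ`, and (ii) `|H_d|` divides `∏_{ℓ ∣ c/d prime} (ℓ + (−1)^i)`.  Then
`∑_ψ ((c_ψ/c)·n_ψ)^i·e_ψ` is the image of a unit of `ℤ_p[A]` under the canonical ring
homomorphism `ℤ_p[A] → K[A]` induced by `ℤ_p → ℚ_p → K`. -/
theorem statement2 (p : ℕ) [Fact (Nat.Prime p)] (hodd : Odd p)
    (A : Type) [CommGroup A] [Fintype A]
    (c : ℕ) (hc : 0 < c) (hsq : Squarefree c)
    (K : Type) [Field K] [Algebra ℚ_[p] K] [IsAlgClosure ℚ_[p] K]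
    (cChar : (A →* Kˣ) → ℕ)
    (hcChar : ∀ ψ : A →* Kˣ, 0 < cChar ψ ∧ cChar ψ ∣ c)
    (i : ℕ) (hi : i = 1 ∨ i = 2)
    (hH : ∀ d : ℕ, 0 < d → d ∣ c → ∃ H : Subgroup A,
      (∀ ψ : A →* Kˣ, cChar ψ ∣ d ↔ H ≤ ψ.ker) ∧
      ((Nat.card H : ℤ) ∣ ∏ ℓ ∈ (c / d).primeFactors, ((ℓ : ℤ) + (-1) ^ i))) :
    ∃ u : (MonoidAlgebra ℤ_[p] A)ˣ,
      coeffRingHom ((algebraMap ℚ_[p] K).comp (algebraMap ℤ_[p] ℚ_[p])) A (↑u : MonoidAlgebra ℤ_[p] A) =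
        ∑ᶠ ψ : A →* Kˣ,
          (((cChar ψ : K) / (c : K)) *
              (if p ∣ c ∧ ¬ p ∣ cChar ψ then (p : K) else 1)) ^ i •
            ((Fintype.card A : K)⁻¹ •
              ∑ g : A, (((ψ g)⁻¹ : Kˣ) : K) • MonoidAlgebra.of K A g) := by
  classical
  have hp : p.Prime := Fact.out
  have : IsAlgClosed K := IsAlgClosure.isAlgClosed ℚ_[p]
  have : CharZero K := charZero_of_injective_algebraMap (algebraMap ℚ_[p] K).injective
  have := Fintype.ofFinite (A →* Kˣ)
  set f : ℤ_[p] →+* K := (algebraMap ℚ_[p] K).comp (algebraMap ℤ_[p] ℚ_[p])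
  have hfinj : Function.Injective f :=
    (algebraMap ℚ_[p] K).injective.comp (FaithfulSMul.algebraMap_injective ℤ_[p] ℚ_[p])
  set S := c.primeFactors.erase p
  have hunit (ℓ : ℕ) (hℓ : ℓ ∈ S) : IsUnit (ℓ : ℤ_[p]) :=
    PadicInt.isUnit_natCast_of_prime (Nat.prime_of_mem_primeFactors (mem_of_mem_erase hℓ))
      (ne_of_mem_erase hℓ)
  have hex (t : ℕ → ℤ_[p]) (ht : ∀ ℓ ∈ S, (ℓ : ℤ_[p]) + (-1) ^ i ∣ t ℓ) :=
    exists_charEval_eq_prod f S t (fun (ψ : A →* Kˣ) ℓ => ¬ ℓ ∣ cChar ψ) fun T hT => by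
      have hTc : T ⊆ c.primeFactors := hT.trans (erase_subset _ _)
      have hdvd : ∏ ℓ ∈ T, ℓ ∣ c :=
        (prod_dvd_prod_of_subset _ _ _ hTc).trans (Nat.prod_primeFactors_dvd c)
      obtain ⟨H, hker, hcard⟩ := hH (c / ∏ ℓ ∈ T, ℓ)
        (Nat.div_pos (Nat.le_of_dvd hc hdvd) (Nat.pos_of_dvd_of_pos hdvd hc))
        (Nat.div_dvd_of_dvd hdvd)
      refine ⟨H, fun ψ => (hker ψ).symm.trans (hsq.dvd_div_prod_iff (hcChar ψ).2 hTc), ?_⟩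
      rw [Nat.div_div_self hdvd hc.ne',
        Nat.primeFactors_prod fun ℓ hℓ => Nat.prime_of_mem_primeFactors (hTc hℓ)] at hcard
      have hcast := map_dvd (Int.castRingHom ℤ_[p]) hcard
      simp only [map_prod, map_natCast, map_add, map_pow, map_neg, map_one] at hcast
      exact hcast.trans (prod_dvd_prod_of_dvd _ _ fun ℓ hℓ => ht ℓ (hT hℓ))
  obtain ⟨y, hy⟩ := hex (fun ℓ => Ring.inverse (ℓ : ℤ_[p]) ^ i - 1) fun ℓ hℓ => by
    have hinv : Ring.inverse (ℓ : ℤ_[p]) ^ i * (ℓ : ℤ_[p]) ^ i = 1 := by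
      rw [← mul_pow, Ring.inverse_mul_cancel _ (hunit ℓ hℓ), one_pow]
    refine (add_neg_one_pow_dvd_pow_sub_one (ℓ : ℤ_[p]) hi).trans
      ⟨-Ring.inverse (ℓ : ℤ_[p]) ^ i, ?_⟩
    linear_combination hinv
  obtain ⟨z, hz⟩ := hex (fun ℓ => (ℓ : ℤ_[p]) ^ i - 1) fun ℓ _ =>
    add_neg_one_pow_dvd_pow_sub_one _ hi
  have hfinv (ℓ : ℕ) (hℓ : ℓ ∈ S) : f (Ring.inverse (ℓ : ℤ_[p])) = (ℓ : K)⁻¹ := by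
    refine eq_inv_of_mul_eq_one_left ?_
    rw [← map_natCast f ℓ, ← map_mul, Ring.inverse_mul_cancel _ (hunit ℓ hℓ), map_one]
  have hyz : y * z = 1 := coeffRingHom_injective hfinj <| charEval_ext fun ψ => by
    rw [map_mul, map_mul, hy, hz, ← prod_mul_distrib, map_one, map_one]
    refine prod_eq_one fun ℓ hℓ => ?_
    split_ifs
    · exact one_mul 1
    · rw [← map_mul, add_sub_cancel, add_sub_cancel, ← mul_pow,
        Ring.inverse_mul_cancel _ (hunit ℓ hℓ), one_pow, map_one]
  refine ⟨Units.mkOfMulEqOne y z hyz, ?_⟩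
  rw [Units.val_mkOfMulEqOne, finsum_eq_sum_of_fintype,
    ← sum_charEval_smul_idempotent (coeffRingHom f A y)]
  refine sum_congr rfl fun ψ _ => ?_
  congr 1
  rw [hy]
  have hcK := congrArg (Nat.cast : ℕ → K) (hsq.eq_mul_prod_erase (hcChar ψ).2 hp)
  push_cast at hcK
  have hc0 : (c : K) ≠ 0 := Nat.cast_ne_zero.mpr hc.ne'
  have hprod : ∏ ℓ ∈ S, (if ¬ ℓ ∣ cChar ψ then
        f (1 + (Ring.inverse (ℓ : ℤ_[p]) ^ i - 1)) else 1) =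
      (∏ ℓ ∈ S, if ¬ ℓ ∣ cChar ψ then (ℓ : K) else 1)⁻¹ ^ i := by
    rw [← prod_inv_distrib, ← prod_pow]
    refine prod_congr rfl fun ℓ hℓ => ?_
    split_ifs
    · simp
    · rw [add_sub_cancel, map_pow, hfinv ℓ hℓ]
  rw [hprod]
  congr 1
  rw [hcK] at hc0
  rw [inv_eq_iff_eq_inv, mul_comm, ← mul_div_assoc, inv_div, mul_comm _ (cChar ψ : K),
    eq_div_iff (left_ne_zero_of_mul hc0), mul_comm, ← hcK]
end

section
/- Let c be a real number with the following property: for every prime number p and every ring homomorphism j : ℝ → A_p, where A_p denotes an algebraic closure of the field ℚ_p of p-adic numbers, the element j(c) lies in the image of the canonical map ℚ_p → A_p. Then c is a rational number. -/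
open Cardinal Polynomial NumberField IntermediateField

/-- An extension of a countable field embeds into any uncountable algebraically closed extension
of at least the same cardinality. -/
theorem nonempty_algHom_of_countable {F E M : Type} [Field F] [Field E] [Field M] [Algebra F E]
    [Algebra F M] [Countable F] [IsAlgClosed M] (hM : ℵ₀ < #M) (hEM : #E ≤ #M) :
    Nonempty (E →ₐ[F] M) := by
  obtain ⟨s, hs⟩ := exists_isTranscendenceBasis F E
  obtain ⟨t, ht⟩ := exists_isTranscendenceBasis F M
  have hst : #s ≤ #t := by
    rw [← IsAlgClosed.cardinal_eq_cardinal_transcendence_basis_of_aleph0_lt' _ ht mk_le_aleph0 hM]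
    exact (mk_set_le s).trans hEM
  obtain ⟨e⟩ := hst
  let A := Algebra.adjoin F (Set.range ((↑) : s → E))
  let g : A →ₐ[F] M :=
    (MvPolynomial.aeval fun i => (e i : M)).comp hs.1.aevalEquiv.symm.toAlgHom
  have hg : Function.Injective g :=
    (show Function.Injective (MvPolynomial.aeval (R := F) fun i => (e i : M)) from
      ht.1.comp e e.injective).comp hs.1.aevalEquiv.symm.injective
  let : Algebra A M := g.toRingHom.toAlgebra
  have : IsScalarTower F A M := .of_algebraMap_eq fun x => (g.commutes x).symm
  have : FaithfulSMul A M := (faithfulSMul_iff_algebraMap_injective A M).2 hg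
  have : Module.IsTorsionFree A M := inferInstance
  have : Algebra.IsAlgebraic A E := hs.isAlgebraic
  exact ⟨(IsAlgClosed.lift : E →ₐ[A] M).restrictScalars F⟩

theorem continuum_le_mk_algebraicClosure_padic (p : ℕ) [Fact p.Prime] :
    𝔠 ≤ #(AlgebraicClosure ℚ_[p]) :=
  (continuum_le_cardinal_of_nontriviallyNormedField ℚ_[p]).trans
    (mk_le_of_injective (algebraMap ℚ_[p] (AlgebraicClosure ℚ_[p])).injective)

/-- Every embedding of a countable subfield of `ℝ` into `AlgebraicClosure ℚ_[p]` extends to `ℝ`. -/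
theorem exists_ringHom_real_extending (p : ℕ) [Fact p.Prime] {F : Type} [Field F] [Countable F]
    [Algebra F ℝ] (σ : F →+* AlgebraicClosure ℚ_[p]) :
    ∃ j : ℝ →+* AlgebraicClosure ℚ_[p], ∀ x, j (algebraMap F ℝ x) = σ x := by
  let : Algebra F (AlgebraicClosure ℚ_[p]) := σ.toAlgebra
  have hc := continuum_le_mk_algebraicClosure_padic p
  obtain ⟨j⟩ := nonempty_algHom_of_countable (F := F) (E := ℝ) (aleph0_lt_continuum.trans_le hc)
    (mk_real.trans_le hc)
  exact ⟨j, j.commutes⟩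

theorem Rat.mem_range_intCast_of_forall_padic_norm_le_one (q : ℚ)
    (hq : ∀ (p : ℕ) [Fact p.Prime], ‖(q : ℚ_[p])‖ ≤ 1) : ∃ n : ℤ, (n : ℚ) = q := by
  refine ⟨q.num, Rat.coe_int_num_of_den_eq_one ?_⟩
  by_contra hden
  obtain ⟨p, hp, hpd⟩ := Nat.exists_prime_and_dvd hden
  have : Fact p.Prime := ⟨hp⟩
  have hd : ‖((q.den : ℤ) : ℚ_[p])‖ < 1 :=
    Padic.norm_intCast_lt_one_iff.2 (Int.natCast_dvd_natCast.2 hpd)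
  have hn : ‖(q.num : ℚ_[p])‖ < 1 := by
    have : (q.num : ℚ_[p]) = (q : ℚ_[p]) * ((q.den : ℤ) : ℚ_[p]) := by
      exact_mod_cast congrArg (Rat.cast (K := ℚ_[p])) (Rat.mul_den_eq_num q).symm
    rw [this, norm_mul]
    exact mul_lt_one_of_nonneg_of_lt_one_right (hq p) (norm_nonneg _) hd
  have hpn := Int.natCast_dvd.1 (Padic.norm_intCast_lt_one_iff.1 hn)
  exact hp.one_lt.ne' (Nat.eq_one_of_dvd_coprimes q.reduced hpn hpd)

theorem Padic.exists_padicInt_of_isIntegral {p : ℕ} [Fact p.Prime] {x : ℚ_[p]}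
    (hx : IsIntegral ℤ_[p] (algebraMap ℚ_[p] (AlgebraicClosure ℚ_[p]) x)) :
    ∃ z : ℤ_[p], (z : ℚ_[p]) = x :=
  IsIntegrallyClosed.isIntegral_iff.1
    ((isIntegral_algebraMap_iff (algebraMap ℚ_[p] (AlgebraicClosure ℚ_[p])).injective).1 hx)

theorem NumberField.isIntegral_of_forall_padic {K : Type} [Field K] [NumberField K] (x : K)
    (hx : ∀ (p : ℕ) [Fact p.Prime] (σ : K →+* AlgebraicClosure ℚ_[p]), IsIntegral ℤ_[p] (σ x)) :
    IsIntegral ℤ x := by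
  have hxQ : IsIntegral ℚ x := Algebra.IsIntegral.isIntegral x
  have hmon := minpoly.monic hxQ
  have hcoeff : ∀ i, ∃ n : ℤ, (n : ℚ) = (minpoly ℚ x).coeff i := by
    intro i
    refine Rat.mem_range_intCast_of_forall_padic_norm_le_one _ fun p _ => ?_
    have hi : IsIntegral ℤ_[p]
        (((minpoly ℚ x).map (algebraMap ℚ (AlgebraicClosure ℚ_[p]))).coeff i) := by
      refine Polynomial.isIntegral_coeff_of_factors _ ?_ (IsAlgClosed.splits _) (fun y hy => ?_) i
      · rw [(hmon.map _).leadingCoeff]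
        exact isIntegral_one
      · have hy' : y ∈ (minpoly ℚ x).rootSet (AlgebraicClosure ℚ_[p]) :=
          Polynomial.mem_rootSet.2 ⟨hmon.ne_zero, by
            rwa [IsRoot, eval_map_algebraMap] at hy⟩
        rw [← Algebra.IsAlgebraic.range_eval_eq_rootSet_minpoly] at hy'
        obtain ⟨σ, rfl⟩ := hy'
        exact hx p σ.toRingHom
    rw [coeff_map, eq_ratCast,
      ← map_ratCast (algebraMap ℚ_[p] (AlgebraicClosure ℚ_[p]))] at hi
    obtain ⟨z, hz⟩ := Padic.exists_padicInt_of_isIntegral hi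
    rw [← hz]
    exact z.2
  have hlift : minpoly ℚ x ∈ lifts (algebraMap ℤ ℚ) :=
    (lifts_iff_coeff_lifts _).2 fun i => by simpa using hcoeff i
  obtain ⟨P, hP, -, hPm⟩ := lifts_and_degree_eq_and_monic hlift hmon
  refine ⟨P, hPm, ?_⟩
  rw [← aeval_def, ← aeval_map_algebraMap ℚ, hP, minpoly.aeval]

/-- A number field all of whose embeddings into `AlgebraicClosure ℚ_[p]` have image in `ℚ_[p]`
has discriminant prime to `p`. -/
theorem NumberField.not_dvd_discr_of_forall_mem_range {K : Type} [Field K] [NumberField K]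
    (p : ℕ) [hp : Fact p.Prime]
    (h : ∀ (σ : K →+* AlgebraicClosure ℚ_[p]) (x : K),
      σ x ∈ Set.range (algebraMap ℚ_[p] (AlgebraicClosure ℚ_[p]))) :
    ¬ (p : ℤ) ∣ discr K := by
  classical
  intro hdvd
  let A := AlgebraicClosure ℚ_[p]
  let b := RingOfIntegers.basis K
  have e : Module.Free.ChooseBasisIndex ℤ (𝓞 K) ≃ (K →ₐ[ℚ] A) :=
    Fintype.equivOfCardEq <| by
      rw [AlgHom.card, Module.finrank_eq_card_basis (integralBasis K)]
  have hint : ∀ i j, ∃ z : ℤ_[p], algebraMap ℤ_[p] A z = e j (b i) := by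
    intro i j
    obtain ⟨y, hy⟩ := h (e j).toRingHom (b i)
    have hbi : IsIntegral ℤ (e j (b i)) :=
      (RingOfIntegers.isIntegral_coe (b i)).map ((e j).restrictScalars ℤ)
    have hyi : IsIntegral ℤ_[p] (algebraMap ℚ_[p] A y) := by
      rw [hy]
      exact hbi.tower_top
    obtain ⟨z, rfl⟩ := Padic.exists_padicInt_of_isIntegral hyi
    exact ⟨z, hy⟩
  choose M hM using hint
  have hinj : Function.Injective (algebraMap ℤ_[p] A) :=
    (algebraMap ℚ_[p] A).injective.comp Subtype.val_injective
  have hdet : (Matrix.of M).det ^ 2 = (discr K : ℤ_[p]) := by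
    apply hinj
    have hd := Algebra.discr_eq_det_embeddingsMatrixReindex_pow_two ℚ A (integralBasis K) e
    rw [← coe_discr] at hd
    rw [map_pow, RingHom.map_det, map_intCast, ← map_intCast (algebraMap ℚ A), hd]
    congr 2
    ext i j
    simp [Algebra.embeddingsMatrixReindex, Algebra.embeddingsMatrix, hM, b]
  have hdet0 : ((Matrix.of M).map PadicInt.toZMod).det = 0 := by
    have h0 := congrArg PadicInt.toZMod hdet
    rw [map_pow, map_intCast, (ZMod.intCast_zmod_eq_zero_iff_dvd _ p).2 hdvd, RingHom.map_det] at h0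
    exact pow_eq_zero_iff two_ne_zero |>.1 h0
  obtain ⟨v, hv0, hv⟩ := Matrix.exists_vecMul_eq_zero_iff.2 hdet0
  let β : 𝓞 K := ∑ i, ((v i).val : ℤ) • b i
  have hβ : ∀ j, ∃ w : ℤ_[p], e j β = algebraMap ℤ_[p] A (p * w) := by
    intro j
    have hker : PadicInt.toZMod (∑ i, ((v i).val : ℤ_[p]) * M i j) = 0 := by
      simpa [Matrix.vecMul, dotProduct] using congrFun hv j
    rw [← RingHom.mem_ker, PadicInt.ker_toZMod, PadicInt.maximalIdeal_eq_span_p,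
      Ideal.mem_span_singleton] at hker
    obtain ⟨w, hw⟩ := hker
    refine ⟨w, ?_⟩
    rw [← hw]
    simp only [β, map_sum, map_mul, map_natCast, hM, zsmul_eq_mul,
      Int.cast_natCast]
  have hp0 : (p : K) ≠ 0 := Nat.cast_ne_zero.2 hp.out.ne_zero
  have hγ : IsIntegral ℤ ((β : K) / p) := by
    refine isIntegral_of_forall_padic _ fun l hl σ => ?_
    by_cases hlp : l = p
    · subst hlp
      obtain ⟨j, hj⟩ := e.surjective σ.toRatAlgHom
      obtain ⟨w, hw⟩ := hβ j
      have hw' : σ ((β : K) / l) = algebraMap ℤ_[l] A w := by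
        have : σ β = algebraMap ℤ_[l] A (l * w) := by rw [← hw, hj]; rfl
        rw [map_div₀, map_natCast, this, map_mul, map_natCast,
          mul_div_cancel_left₀ _ (Nat.cast_ne_zero.2 hl.out.ne_zero)]
      rw [hw']
      exact isIntegral_algebraMap
    · have hu : IsUnit (p : ℤ_[l]) :=
        PadicInt.isUnit_iff.2 <| PadicInt.norm_natCast_eq_one_iff.2 <|
          (Nat.coprime_primes hl.out hp.out).2 hlp
      obtain ⟨u, hu⟩ := hu.exists_right_inv
      have hu' : (p : AlgebraicClosure ℚ_[l])⁻¹ = algebraMap ℤ_[l] _ u := by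
        apply inv_eq_of_mul_eq_one_right
        rw [← map_natCast (algebraMap ℤ_[l] (AlgebraicClosure ℚ_[l])), ← map_mul, hu, map_one]
      rw [map_div₀, map_natCast, div_eq_mul_inv, hu']
      exact (((RingOfIntegers.isIntegral_coe β).map σ.toIntAlgHom).tower_top).mul
        isIntegral_algebraMap
  let γ : 𝓞 K := ⟨(β : K) / p, hγ⟩
  have hβγ : β = (p : ℤ) • γ := by
    apply RingOfIntegers.ext
    rw [zsmul_eq_mul, Int.cast_natCast]
    refine Eq.trans ?_ (map_mul (algebraMap (𝓞 K) K) _ _).symm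
    rw [map_natCast]
    exact (mul_div_cancel₀ (β : K) hp0).symm
  apply hv0
  funext i
  have hrepr : ((v i).val : ℤ) = p * b.repr γ i := by
    have h1 : b.repr β i = ((v i).val : ℤ) := by
      simp only [β]
      rw [b.repr_sum_self]
    rw [← h1, hβγ, map_zsmul, Finsupp.smul_apply, smul_eq_mul]
  have h2 := congrArg (Int.cast : ℤ → ZMod p) hrepr
  simpa using h2

/-- The only number field all of whose `p`-adic embeddings land in `ℚ_[p]`, for every prime `p`,
is `ℚ`. -/
theorem NumberField.finrank_eq_one_of_forall_mem_range {K : Type} [Field K] [NumberField K]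
    (h : ∀ (p : ℕ) [Fact p.Prime] (σ : K →+* AlgebraicClosure ℚ_[p]) (x : K),
      σ x ∈ Set.range (algebraMap ℚ_[p] (AlgebraicClosure ℚ_[p]))) :
    Module.finrank ℚ K = 1 := by
  by_contra hne
  have hlt : 1 < Module.finrank ℚ K :=
    lt_of_le_of_ne Module.finrank_pos (Ne.symm hne)
  have hd := abs_discr_gt_two hlt
  obtain ⟨p, hp, hpd⟩ := Nat.exists_prime_and_dvd (n := (discr K).natAbs) (by zify; omega)
  have : Fact p.Prime := ⟨hp⟩
  exact not_dvd_discr_of_forall_mem_range p (h p) (Int.natCast_dvd.2 hpd)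

/-- There are elements of `AlgebraicClosure ℚ_[p]` outside `ℚ_[p]` and transcendental over `ℚ`. -/
theorem exists_transcendental_notMem_range_padic (p : ℕ) [hp : Fact p.Prime] :
    ∃ t : AlgebraicClosure ℚ_[p], Transcendental ℚ t ∧
      t ∉ Set.range (algebraMap ℚ_[p] (AlgebraicClosure ℚ_[p])) := by
  let A := AlgebraicClosure ℚ_[p]
  have hu : ℵ₀ < #A := aleph0_lt_continuum.trans_le (continuum_le_mk_algebraicClosure_padic p)
  obtain ⟨t, ht⟩ : ∃ t : A, Transcendental ℚ t := by
    by_contra! hall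
    have : Algebra.IsAlgebraic ℚ A := ⟨fun x => by simpa [Transcendental] using hall x⟩
    exact hu.not_ge ((Algebra.IsAlgebraic.cardinalMk_le_max ℚ A).trans (by simp))
  by_cases htr : t ∈ Set.range (algebraMap ℚ_[p] A)
  swap
  · exact ⟨t, ht, htr⟩
  obtain ⟨y, rfl⟩ := htr
  obtain ⟨a, ha⟩ := IsAlgClosed.exists_pow_nat_eq (p : A) two_pos
  have hp0 : (p : A) ≠ 0 := Nat.cast_ne_zero.2 hp.out.ne_zero
  have ha0 : a ≠ 0 := by
    rintro rfl
    simp [hp0.symm] at ha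
  have haalg : IsAlgebraic ℚ a := by
    refine IsAlgebraic.of_pow two_pos ?_
    rw [ha]
    exact isAlgebraic_natCast p
  refine ⟨algebraMap ℚ_[p] A y * a, fun hya => ht ?_, ?_⟩
  · simpa [ha0] using hya.mul haalg.inv
  · rintro ⟨z, hz⟩
    have hy0 : y ≠ 0 := by
      rintro rfl
      exact ht (by simpa using isAlgebraic_zero)
    have hsq : (z / y) ^ 2 = p := by
      apply (algebraMap ℚ_[p] A).injective
      have : algebraMap ℚ_[p] A y ≠ 0 := by simpa using hy0
      rw [map_pow, map_div₀, hz, mul_div_cancel_left₀ _ this, ha, map_natCast]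
    have hval := congrArg Padic.valuation hsq
    rw [Padic.valuation_pow, Padic.valuation_p] at hval
    omega

theorem exists_algHom_adjoin_simple_of_transcendental {F E M : Type*} [Field F] [Field E] [Field M]
    [Algebra F E] [Algebra F M] {x : E} {y : M} (hx : Transcendental F x)
    (hy : Transcendental F y) : ∃ σ : F⟮x⟯ →ₐ[F] M, σ (AdjoinSimple.gen F x) = y :=
  ⟨F⟮y⟯.val.comp ((RatFunc.algEquivOfTranscendental x hx).symm.trans
    (RatFunc.algEquivOfTranscendental y hy)).toAlgHom, by simp⟩

/-- Let `c` be a real number such that for every prime `p` and every ring homomorphism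
`j : ℝ → A_p` into an algebraic closure `A_p` of `ℚ_p`, the element `j(c)` lies in the image
of the canonical map `ℚ_p → A_p`.  Then `c` is rational. -/
theorem statement5 (c : ℝ)
    (h : ∀ (p : ℕ) [Fact (Nat.Prime p)] (Ap : Type) [Field Ap] [Algebra ℚ_[p] Ap]
      [IsAlgClosure ℚ_[p] Ap] (j : ℝ →+* Ap), j c ∈ Set.range (algebraMap ℚ_[p] Ap)) :
    ∃ q : ℚ, c = (q : ℝ) := by
  have hcount : Countable ℚ⟮c⟯ := by
    rw [← mk_le_aleph0_iff]
    exact (cardinalMk_adjoin_le ℚ {c}).trans (by simp)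
  have hgen (p : ℕ) [Fact p.Prime] (σ : ℚ⟮c⟯ →+* AlgebraicClosure ℚ_[p]) :
      σ (AdjoinSimple.gen ℚ c) ∈ Set.range (algebraMap ℚ_[p] (AlgebraicClosure ℚ_[p])) := by
    obtain ⟨j, hj⟩ := exists_ringHom_real_extending p σ
    rw [← hj]
    exact h p _ j
  by_cases hc : IsIntegral ℚ c
  · have : FiniteDimensional ℚ ℚ⟮c⟯ := adjoin.finiteDimensional hc
    have : NumberField ℚ⟮c⟯ := { }
    have hone : Module.finrank ℚ ℚ⟮c⟯ = 1 := by
      refine NumberField.finrank_eq_one_of_forall_mem_range fun p _ σ x => ?_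
      obtain ⟨f, rfl⟩ := (adjoin.powerBasis hc).exists_eq_aeval' x
      obtain ⟨y, hy⟩ := hgen p σ
      refine ⟨eval₂ (algebraMap ℚ ℚ_[p]) y f, ?_⟩
      rw [adjoin.powerBasis_gen, aeval_def, hom_eval₂, hom_eval₂, hy]
      congr 1
      exact Subsingleton.elim _ _
    rw [finrank_adjoin_simple_eq_one_iff, mem_bot] at hone
    obtain ⟨q, hq⟩ := hone
    exact ⟨q, by simpa using hq.symm⟩
  · exfalso
    obtain ⟨t, ht, htr⟩ := exists_transcendental_notMem_range_padic 2
    have hct : Transcendental ℚ c := fun hca => hc hca.isIntegral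
    obtain ⟨σ, hσ⟩ := exists_algHom_adjoin_simple_of_transcendental hct ht
    exact htr (hσ ▸ hgen 2 σ.toRingHom)
end

section
/- Let p be a prime number and let A_p be an algebraic closure of the field ℚ_p of p-adic numbers. If c is a real number that is transcendental over ℚ, then there exists a ring homomorphism j : ℝ → A_p such that j(c) does not lie in the image of the canonical map ℚ_p → A_p. -/
open Cardinal in
/-- A transcendental element of a field of characteristic zero can be sent to any transcendental
element of an uncountable algebraically closed field of at least the same cardinality. -/
theorem exists_ringHom_apply_eq_of_transcendental {K L : Type} [Field K] [Field L] [CharZero K]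
    [CharZero L] [IsAlgClosed L] (hKL : #K ≤ #L) (hL : ℵ₀ < #L) {c : K} {t : L}
    (hc : Transcendental ℚ c) (ht : Transcendental ℚ t) : ∃ j : K →+* L, j c = t := by
  classical
  obtain ⟨S, hcS, hS⟩ := exists_isTranscendenceBasis_superset (R := ℚ) (s := {c})
    (algebraicIndependent_unique_type_iff.2 hc)
  obtain ⟨T, htT, hT⟩ := exists_isTranscendenceBasis_superset (R := ℚ) (s := {t})
    (algebraicIndependent_unique_type_iff.2 ht)
  have hTcard : #L = #T :=
    IsAlgClosed.cardinal_eq_cardinal_transcendence_basis_of_aleph0_lt' _ hT (by simp) hL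
  obtain ⟨g⟩ : Nonempty (S ↪ T) := ((mk_set_le S).trans hKL).trans_eq hTcard
  let c' : S := ⟨c, hcS rfl⟩
  let t' : T := ⟨t, htT rfl⟩
  let f : S ↪ T := g.trans (Equiv.swap (g c') t').toEmbedding
  have hfc : f c' = t' := Equiv.swap_apply_left _ _
  have hf : AlgebraicIndependent ℚ (fun s : S ↦ (f s : L)) := hT.1.comp f f.injective
  let φ := (MvPolynomial.aeval (R := ℚ) (fun s : S ↦ (f s : L))).comp
    hS.1.aevalEquiv.symm.toAlgHom
  have hφ : Function.Injective φ :=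
    (show Function.Injective (MvPolynomial.aeval (R := ℚ) (fun s : S ↦ (f s : L))) from hf).comp
      hS.1.aevalEquiv.symm.injective
  let _ := φ.toRingHom.toAlgebra
  have : FaithfulSMul (Algebra.adjoin ℚ (Set.range ((↑) : S → K))) L :=
    (faithfulSMul_iff_algebraMap_injective _ _).2 hφ
  have := hS.isAlgebraic
  let j : K →ₐ[Algebra.adjoin ℚ (Set.range ((↑) : S → K))] L := IsAlgClosed.lift
  refine ⟨j, ?_⟩
  have hj := j.commutes (hS.1.aevalEquiv (MvPolynomial.X c'))
  rw [hS.1.algebraMap_aevalEquiv, MvPolynomial.aeval_X] at hj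
  refine hj.trans ?_
  change φ _ = t
  simp [φ, hfc, t']

theorem Padic.sq_ne_prime (p : ℕ) [Fact p.Prime] (x : ℚ_[p]) : x ^ 2 ≠ p := by
  intro h
  have hp : (1 : ℝ) < p := mod_cast (Fact.out : p.Prime).one_lt
  have hx : x ≠ 0 := by
    rintro rfl
    have := (Fact.out : p.Prime).ne_zero
    simp_all [eq_comm]
  have hn := congrArg norm h
  rw [norm_pow, Padic.norm_p, Padic.norm_eq_zpow_neg_valuation hx, ← zpow_natCast, ← zpow_mul,
    ← zpow_neg_one] at hn
  have := zpow_right_injective₀ (by linarith) hp.ne' hn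
  push_cast at this
  omega

theorem Padic.exists_transcendental_notMem_range (p : ℕ) [Fact p.Prime] (L : Type) [Field L]
    [Algebra ℚ_[p] L] [CharZero L] [IsAlgClosed L] {z : L} (hz : Transcendental ℚ z) :
    ∃ t : L, Transcendental ℚ t ∧ t ∉ Set.range (algebraMap ℚ_[p] L) := by
  obtain ⟨r, hr⟩ := IsAlgClosed.exists_pow_nat_eq (p : L) (n := 2) two_pos
  have hr_alg : IsAlgebraic ℚ r :=
    IsAlgebraic.of_pow two_pos (hr ▸ isAlgebraic_natCast p)
  by_contra! h
  obtain ⟨a, ha⟩ := h z hz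
  obtain ⟨b, hb⟩ := h (z + r) fun h' ↦ hz (by simpa using h'.sub hr_alg)
  apply sq_ne_prime p (b - a)
  apply (algebraMap ℚ_[p] L).injective
  simp [ha, hb, hr]

/-- Let `p` be a prime and `A_p` an algebraic closure of `ℚ_p`.  If `c` is a real number that
is transcendental over `ℚ`, then there is a ring homomorphism `j : ℝ → A_p` with `j(c)` not in
the image of the canonical map `ℚ_p → A_p`. -/
theorem statement6 (p : ℕ) [Fact (Nat.Prime p)] (Ap : Type) [Field Ap]
    [Algebra ℚ_[p] Ap] [IsAlgClosure ℚ_[p] Ap] (c : ℝ) (hc : Transcendental ℚ c) :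
    ∃ j : ℝ →+* Ap, j c ∉ Set.range (algebraMap ℚ_[p] Ap) := by
  have : IsAlgClosed Ap := IsAlgClosure.isAlgClosed ℚ_[p]
  have : CharZero Ap := charZero_of_injective_algebraMap (algebraMap ℚ_[p] Ap).injective
  have hcard : Cardinal.continuum ≤ Cardinal.mk Ap :=
    (continuum_le_cardinal_of_nontriviallyNormedField ℚ_[p]).trans
      (Cardinal.mk_le_of_injective (algebraMap ℚ_[p] Ap).injective)
  have hlt := Cardinal.aleph0_lt_continuum.trans_le hcard
  obtain ⟨z, hz⟩ : ∃ z : Ap, Transcendental ℚ z := by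
    by_contra! h
    have : Algebra.IsAlgebraic ℚ Ap := ⟨fun x ↦ not_not.1 (h x)⟩
    exact hlt.not_ge (by simpa using Algebra.IsAlgebraic.cardinalMk_le_max ℚ Ap)
  obtain ⟨t, ht, htr⟩ := Padic.exists_transcendental_notMem_range p Ap hz
  obtain ⟨j, hj⟩ := exists_ringHom_apply_eq_of_transcendental
    (Cardinal.mk_real.trans_le hcard) hlt hc ht
  exact ⟨j, hj ▸ htr⟩
end
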